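/- Allocation lower bound for 1-uniform safe strategies, part 2: let b* = ⟨(b*_1,q*_1),…,(b*_m,q*_m)⟩ be an m-uniform strategy with cumulative quantities Q*_j, and let β₋ and β₋' be two competing-bid profiles against both of which b* satisfies the RoI constraint. Suppose for some j ∈ {1,…,m}: Q*_{j−1} < x(b*;β₋) < Q*_j, and Q*_{j−1} < x(b*;β₋') ≤ Q*_j with x(b*;β₋') ≤ x(b*;β₋). Set r = x(b*;β₋). Then the 1-uniform strategy (w_r, r) is allocated at least x(b*;β₋') units against β₋': x((w_r,r);β₋') ≥ x(b*;β₋'). -/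

import Mathlib

open Finset

namespace Auction

/-- A competing-bid profile for an auction of `K` identical units, represented by the
function sending `j ∈ {1,…,K}` to the `j`-th smallest element of the multiset of the
`K` largest competing bids. -/
structure Profile (K : ℕ) where
  c : ℕ → ℝ
  mono : ∀ i j : ℕ, 1 ≤ i → i ≤ j → j ≤ K → c i ≤ c j
  nonneg : ∀ j : ℕ, 1 ≤ j → j ≤ K → 0 ≤ c j

/-- A bid vector: `n` units are demanded and `bid j` is the bid for the `j`-th unit
(for `1 ≤ j ≤ n`). -/
structure BidVec where
  n : ℕ
  bid : ℕ → ℝ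

/-- A bid vector is valid if its bids are non-increasing and positive. -/
def BidVec.Valid (b : BidVec) : Prop :=
  (∀ i j : ℕ, 1 ≤ i → i ≤ j → j ≤ b.n → b.bid j ≤ b.bid i) ∧
  ∀ j : ℕ, 1 ≤ j → j ≤ b.n → 0 < b.bid j

open Classical in
/-- The number of units the bidder wins (ties broken in the bidder's favor): the
largest `r ≤ min n K` such that the bidder's `j`-th bid is at least the `j`-th
threshold `β.c j` for every `j ≤ r`. -/
noncomputable def alloc (K : ℕ) (b : BidVec) (β : Profile K) : ℕ :=
  ((Finset.Icc 1 (min b.n K)).filter fun r => ∀ j ∈ Finset.Icc 1 r, β.c j ≤ b.bid j).sup id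

/-- The clearing price: the `K`-th highest among all submitted bids (taken to be `0`
when the bidder wins no unit). -/
noncomputable def price (K : ℕ) (b : BidVec) (β : Profile K) : ℝ :=
  if alloc K b β = 0 then 0
  else if alloc K b β < K then min (b.bid (alloc K b β)) (β.c (alloc K b β + 1))
  else b.bid K

/-- The value obtained by the bidder. -/
noncomputable def value (v : ℕ → ℝ) (K : ℕ) (b : BidVec) (β : Profile K) : ℝ :=
  ∑ j ∈ Finset.Icc 1 (alloc K b β), v j

/-- The bidder's total payment. -/
noncomputable def payment (K : ℕ) (b : BidVec) (β : Profile K) : ℝ :=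
  price K b β * (alloc K b β : ℝ)

/-- The RoI constraint (with target RoI `γ = 0`) against a single competing-bid profile. -/
def Feasible (v : ℕ → ℝ) (K : ℕ) (b : BidVec) (β : Profile K) : Prop :=
  payment K b β ≤ value v K b β

/-- A bid vector is safe if it satisfies the RoI constraint against every profile. -/
def Safe (v : ℕ → ℝ) (K : ℕ) (b : BidVec) : Prop :=
  ∀ β : Profile K, Feasible v K b β

/-- A valuation vector: nonnegative and non-increasing on `{1,…,M}`. -/
def ValidValuation (M : ℕ) (v : ℕ → ℝ) : Prop :=
  (∀ j : ℕ, 1 ≤ j → j ≤ M → 0 ≤ v j) ∧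
  ∀ i j : ℕ, 1 ≤ i → i ≤ j → j ≤ M → v j ≤ v i

/-- The average cumulative valuation `w_j = (v_1 + ⋯ + v_j) / j`. -/
noncomputable def w (v : ℕ → ℝ) (j : ℕ) : ℝ :=
  (∑ ℓ ∈ Finset.Icc 1 j, v ℓ) / (j : ℝ)

/-- An `m`-uniform bidding strategy: bid-quantity pairs `(b j, q j)` for `1 ≤ j ≤ m`. -/
structure Uniform where
  m : ℕ
  b : ℕ → ℝ
  q : ℕ → ℕ

/-- Cumulative quantities `Q j = q 1 + ⋯ + q j`. -/
def Uniform.Q (s : Uniform) (j : ℕ) : ℕ := ∑ ℓ ∈ Finset.Icc 1 j, s.q ℓ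

/-- `s` is a genuine `m`-uniform strategy for maximum demand `M`:
`b 1 > b 2 > ⋯ > b m > 0`, positive quantities, and `Q m ≤ M`. -/
def Uniform.IsUniform (M : ℕ) (s : Uniform) : Prop :=
  1 ≤ s.m ∧
  (∀ j : ℕ, 1 ≤ j → j ≤ s.m → 0 < s.q j) ∧
  0 < s.b s.m ∧
  (∀ j : ℕ, 1 ≤ j → j < s.m → s.b (j + 1) < s.b j) ∧
  s.Q s.m ≤ M

/-- The bid vector associated to a uniform strategy: the bid on the `j`-th unit is
`b ℓ`, where `ℓ` is least with `j ≤ Q ℓ`. -/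
noncomputable def Uniform.toBidVec (s : Uniform) : BidVec :=
  ⟨s.Q s.m, fun j => s.b (sInf {ℓ : ℕ | j ≤ s.Q ℓ})⟩

/-- The 1-uniform strategy bidding `b` on `q` units. -/
def single (b : ℝ) (q : ℕ) : Uniform := ⟨1, fun _ => b, fun _ => q⟩

/-- Membership in the class `𝒫*_{≤ m}` of safe undominated strategies with at most `m`
bid-quantity pairs: strategies determined by a tuple `0 < Q 1 < ⋯ < Q k ≤ M` (`k ≤ m`)
via `b ℓ = w (Q ℓ)` and `q ℓ = Q ℓ - Q (ℓ-1)`. -/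
def InSafeClass (M : ℕ) (v : ℕ → ℝ) (m : ℕ) (s : Uniform) : Prop :=
  1 ≤ s.m ∧ s.m ≤ m ∧ (∀ j : ℕ, 1 ≤ j → j ≤ s.m → 0 < s.q j) ∧ s.Q s.m ≤ M ∧
  ∀ ℓ : ℕ, 1 ≤ ℓ → ℓ ≤ s.m → s.b ℓ = w v (s.Q ℓ)

/-- Membership in the class `𝒬_{≤ m}(H)` of strategies with at most `m` bid-quantity
pairs that are RoI-feasible for the bid history `H` over rounds `1,…,T`. -/
def InFeasClass (M : ℕ) (v : ℕ → ℝ) (K T : ℕ) (H : ℕ → Profile K) (m : ℕ) (s : Uniform) : Prop :=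
  s.IsUniform M ∧ s.m ≤ m ∧ ∀ t ∈ Finset.Icc 1 T, Feasible v K s.toBidVec (H t)

/-- Total value obtained by strategy `s` over the bid history `H` on rounds `1,…,T`. -/
noncomputable def totalValue (v : ℕ → ℝ) (K T : ℕ) (H : ℕ → Profile K) (s : Uniform) : ℝ :=
  ∑ t ∈ Finset.Icc 1 T, value v K s.toBidVec (H t)

/-- The optimal total value over the class `𝒫*_{≤ m}`. -/
noncomputable def bestSafe (M : ℕ) (v : ℕ → ℝ) (K T : ℕ) (H : ℕ → Profile K) (m : ℕ) : ℝ :=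
  sSup {x : ℝ | ∃ s : Uniform, InSafeClass M v m s ∧ x = totalValue v K T H s}

/-- The optimal total value over the class `𝒬_{≤ m}(H)`. -/
noncomputable def bestFeas (M : ℕ) (v : ℕ → ℝ) (K T : ℕ) (H : ℕ → Profile K) (m : ℕ) : ℝ :=
  sSup {x : ℝ | ∃ s : Uniform, InFeasClass M v K T H m s ∧ x = totalValue v K T H s}

lemma Uniform.Q_mono (s : Uniform) : Monotone s.Q := fun _ _ h =>
  Finset.sum_le_sum_of_subset (Finset.Icc_subset_Icc_right h)

lemma Uniform.toBidVec_bid_eq (s : Uniform) {i j : ℕ} (h1 : s.Q (j - 1) < i) (h2 : i ≤ s.Q j) :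
    s.toBidVec.bid i = s.b j := by
  have hmem : j ∈ {ℓ : ℕ | i ≤ s.Q ℓ} := h2
  have hinf : sInf {ℓ : ℕ | i ≤ s.Q ℓ} = j := by
    refine le_antisymm (Nat.sInf_le hmem) (le_csInf ⟨j, hmem⟩ fun ℓ hℓ => ?_)
    by_contra! hlt
    have hQ : s.Q ℓ ≤ s.Q (j - 1) := s.Q_mono (by omega)
    have hi : i ≤ s.Q ℓ := hℓ
    omega
  simp only [Uniform.toBidVec, hinf]

lemma le_alloc {K : ℕ} {b : BidVec} {β : Profile K} {r : ℕ} (hr : r ≤ min b.n K)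
    (h : ∀ i ∈ Finset.Icc 1 r, β.c i ≤ b.bid i) : r ≤ alloc K b β := by
  rcases Nat.eq_zero_or_pos r with rfl | hpos
  · exact Nat.zero_le _
  · unfold alloc
    refine Finset.le_sup (f := id) ?_
    simp only [Finset.mem_filter]
    exact ⟨Finset.mem_Icc.2 ⟨hpos, hr⟩, h⟩

lemma alloc_spec (K : ℕ) (b : BidVec) (β : Profile K) :
    alloc K b β ≤ min b.n K ∧ ∀ i ∈ Finset.Icc 1 (alloc K b β), β.c i ≤ b.bid i := by
  unfold alloc
  refine Finset.sup_induction
    (p := fun r => r ≤ min b.n K ∧ ∀ i ∈ Finset.Icc 1 r, β.c i ≤ b.bid i) (by simp) ?_ ?_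
  · intro r hr t ht
    rcases le_total r t with h | h
    · rwa [sup_eq_right.2 h]
    · rwa [sup_eq_left.2 h]
  · intro r hr
    simp only [Finset.mem_filter] at hr
    exact ⟨(Finset.mem_Icc.1 hr.1).2, hr.2⟩

lemma bid_succ_alloc_lt {K : ℕ} {b : BidVec} {β : Profile K}
    (hn : alloc K b β < b.n) (hK : alloc K b β < K) :
    b.bid (alloc K b β + 1) < β.c (alloc K b β + 1) := by
  by_contra! hle
  have := le_alloc (K := K) (b := b) (β := β) (r := alloc K b β + 1) (by omega) fun i hi => by
    rw [Finset.mem_Icc] at hi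
    rcases Nat.lt_or_ge (alloc K b β) i with hlt | hge
    · obtain rfl : i = alloc K b β + 1 := by omega
      exact hle
    · exact (alloc_spec K b β).2 i (Finset.mem_Icc.2 ⟨hi.1, hge⟩)
  omega

/-- Lemma `lem:approx1_multiple` (2): let `b*` be an `m`-uniform
strategy feasible against both `β` and `β'`.  If for some `j`,
`Q (j-1) < x(b*;β) < Q j`, `Q (j-1) < x(b*;β') ≤ Q j`, and `x(b*;β') ≤ x(b*;β) = r`,
then the 1-uniform safe strategy `(w r, r)` is allocated at least `x(b*;β')` units
against `β'`. -/
theorem one_uniform_alloc_lower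
    (K M : ℕ) (v : ℕ → ℝ) (hv : ValidValuation M v) (hMK : M ≤ K)
    (s : Uniform) (hs : s.IsUniform M) (β β' : Profile K)
    (hfeas : Feasible v K s.toBidVec β) (hfeas' : Feasible v K s.toBidVec β')
    (j : ℕ) (hj1 : 1 ≤ j) (hjm : j ≤ s.m)
    (h1 : s.Q (j - 1) < alloc K s.toBidVec β) (h2 : alloc K s.toBidVec β < s.Q j)
    (h3 : s.Q (j - 1) < alloc K s.toBidVec β') (h4 : alloc K s.toBidVec β' ≤ s.Q j)
    (h5 : alloc K s.toBidVec β' ≤ alloc K s.toBidVec β) :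
    alloc K s.toBidVec β' ≤
      alloc K (single (w v (alloc K s.toBidVec β)) (alloc K s.toBidVec β)).toBidVec β' := by
  have hQM : s.Q j ≤ s.Q s.m := s.Q_mono hjm
  have hM := hs.2.2.2.2
  have hpos : 0 < alloc K s.toBidVec β := by omega
  have hpos' : 0 < alloc K s.toBidVec β' := by omega
  have hn : s.toBidVec.n = s.Q s.m := rfl
  have hrK : alloc K s.toBidVec β < K := by omega
  have hc := bid_succ_alloc_lt (β := β) (b := s.toBidVec) (by omega) hrK
  rw [s.toBidVec_bid_eq (j := j) (by omega) (by omega)] at hc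
  have hprice : price K s.toBidVec β = s.b j := by
    rw [price, if_neg hpos.ne', if_pos hrK, s.toBidVec_bid_eq h1 h2.le, min_eq_left hc.le]
  have hbw : s.b j ≤ w v (alloc K s.toBidVec β) := by
    rw [w, le_div_iff₀ (by exact_mod_cast hpos), ← hprice]
    exact hfeas
  obtain ⟨hle, hbid⟩ := alloc_spec K s.toBidVec β'
  have hsn : (single (w v (alloc K s.toBidVec β)) (alloc K s.toBidVec β)).toBidVec.n
      = alloc K s.toBidVec β := by
    simp [single, Uniform.toBidVec, Uniform.Q]
  refine le_alloc (by omega) fun i hi => ?_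
  rw [Finset.mem_Icc] at hi
  have hlast := hbid _ (Finset.mem_Icc.2 ⟨hpos', le_rfl⟩)
  rw [s.toBidVec_bid_eq h3 h4] at hlast
  exact (β'.mono i _ hi.1 hi.2 (by omega)).trans (hlast.trans hbw)

end Auction
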